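/- Unary normal form equivalences for half-open intervals: for all metric formulas φ, ψ over A, all m ∈ ℕ with m > 0 and n ∈ ℕ ∪ {ω}, the following equivalences hold over strict timed HT-traces (operators without an interval index carry [0,ω)): φ U_{[m,n)} ψ ≡ ◇_{[m,n)} ψ ∧ ◻_{[0,m)}( φ U (φ ∧ ○ψ) ); φ U_{[0,n)} ψ ≡ ◇_{[0,n)} ψ ∧ (φ U ψ); φ R_{[m,n)} ψ ≡ ◻_{[m,n)} ψ ∨ ◇_{[0,m)}( φ R (φ ∨ ○̂ψ) ); φ R_{[0,n)} ψ ≡ ◻_{[0,n)} ψ ∨ (φ R ψ); φ S_{[m,n)} ψ ≡ ◆_{[m,n)} ψ ∧ ■_{[0,m)}( φ S (φ ∧ •ψ) ); φ S_{[0,n)} ψ ≡ ◆_{[0,n)} ψ ∧ (φ S ψ); φ T_{[m,n)} ψ ≡ ■_{[m,n)} ψ ∨ ◆_{[0,m)}( φ T (φ ∨ •̂ψ) ); φ T_{[0,n)} ψ ≡ ■_{[0,n)} ψ ∨ (φ T ψ). -/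

import Mathlib

/-- Metric formulas over an alphabet `A`.  Each temporal operator carries an
interval `[m, n)` with `m : ℕ` and `n : ℕ∞` (where `⊤` plays the role of `ω`). -/
inductive MForm (A : Type) : Type where
  | bot  : MForm A
  | atom : A → MForm A
  | conj : MForm A → MForm A → MForm A
  | disj : MForm A → MForm A → MForm A
  | impl : MForm A → MForm A → MForm A
  | prev  : ℕ → ℕ∞ → MForm A → MForm A
  | since : ℕ → ℕ∞ → MForm A → MForm A → MForm A
  | trig  : ℕ → ℕ∞ → MForm A → MForm A → MForm A
  | next  : ℕ → ℕ∞ → MForm A → MForm A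
  | untl  : ℕ → ℕ∞ → MForm A → MForm A → MForm A
  | rel   : ℕ → ℕ∞ → MForm A → MForm A → MForm A

/-- Membership of a duration `d` in the interval `[m, n)`. -/
def inIntv (m : ℕ) (n : ℕ∞) (d : ℕ) : Prop := m ≤ d ∧ (d : ℕ∞) < n

/-- Satisfaction `(⟨H,T⟩,τ), k ⊨ φ` for a timed HT-trace of length `len`. -/
def sat {A : Type} : MForm A → (ℕ → Set A) → (ℕ → Set A) → (ℕ → ℕ) → ℕ∞ → ℕ → Prop
  | .bot, _, _, _, _, _ => False
  | .atom p, H, _, _, _, k => p ∈ H k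
  | .conj φ ψ, H, T, τ, len, k => sat φ H T τ len k ∧ sat ψ H T τ len k
  | .disj φ ψ, H, T, τ, len, k => sat φ H T τ len k ∨ sat ψ H T τ len k
  | .impl φ ψ, H, T, τ, len, k =>
      (¬ sat φ H T τ len k ∨ sat ψ H T τ len k) ∧
      (¬ sat φ T T τ len k ∨ sat ψ T T τ len k)
  | .prev m n φ, H, T, τ, len, k =>
      0 < k ∧ sat φ H T τ len (k-1) ∧ inIntv m n (τ k - τ (k-1))
  | .since m n φ ψ, H, T, τ, len, k =>
      ∃ j, j ≤ k ∧ inIntv m n (τ k - τ j) ∧ sat ψ H T τ len j ∧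
        ∀ i, j < i → i ≤ k → sat φ H T τ len i
  | .trig m n φ ψ, H, T, τ, len, k =>
      ∀ j, j ≤ k → inIntv m n (τ k - τ j) →
        (sat ψ H T τ len j ∨ ∃ i, j < i ∧ i ≤ k ∧ sat φ H T τ len i)
  | .next m n φ, H, T, τ, len, k =>
      (k : ℕ∞) + 1 < len ∧ sat φ H T τ len (k+1) ∧ inIntv m n (τ (k+1) - τ k)
  | .untl m n φ ψ, H, T, τ, len, k =>
      ∃ j, k ≤ j ∧ (j : ℕ∞) < len ∧ inIntv m n (τ j - τ k) ∧ sat ψ H T τ len j ∧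
        ∀ i, k ≤ i → i < j → sat φ H T τ len i
  | .rel m n φ ψ, H, T, τ, len, k =>
      ∀ j, k ≤ j → (j : ℕ∞) < len → inIntv m n (τ j - τ k) →
        (sat ψ H T τ len j ∨ ∃ i, k ≤ i ∧ i < j ∧ sat φ H T τ len i)

/-- `(⟨H,T⟩,τ)` is a timed HT-trace of length `len`. -/
def isTrace {A : Type} (H T : ℕ → Set A) (τ : ℕ → ℕ) (len : ℕ∞) : Prop :=
  (∀ i : ℕ, (i : ℕ∞) < len → H i ⊆ T i) ∧
  (∀ i : ℕ, (i : ℕ∞) + 1 < len → τ i ≤ τ (i+1)) ∧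
  τ 0 = 0

/-- Strict timing. -/
def isStrict (τ : ℕ → ℕ) (len : ℕ∞) : Prop :=
  ∀ i : ℕ, (i : ℕ∞) + 1 < len → τ i < τ (i+1)

/-- Negation `¬φ := φ → ⊥`. -/
def mNeg {A : Type} (φ : MForm A) : MForm A := MForm.impl φ MForm.bot

/-- `⊤ := ¬⊥`. -/
def mTop {A : Type} : MForm A := mNeg MForm.bot

/-- Eventually `◇_I φ := ⊤ U_I φ`. -/
def mEvent {A : Type} (m : ℕ) (n : ℕ∞) (φ : MForm A) : MForm A := MForm.untl m n mTop φ

/-- Always `◻_I φ := ⊥ R_I φ`. -/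
def mAlways {A : Type} (m : ℕ) (n : ℕ∞) (φ : MForm A) : MForm A := MForm.rel m n MForm.bot φ

/-- Eventually-before `◆_I φ := ⊤ S_I φ`. -/
def mEvB {A : Type} (m : ℕ) (n : ℕ∞) (φ : MForm A) : MForm A := MForm.since m n mTop φ

/-- Always-before `■_I φ := ⊥ T_I φ`. -/
def mAlwB {A : Type} (m : ℕ) (n : ℕ∞) (φ : MForm A) : MForm A := MForm.trig m n MForm.bot φ

/-- Weak next `○̂_I φ := ○_I φ ∨ ¬○_I ⊤`. -/
def mWNext {A : Type} (m : ℕ) (n : ℕ∞) (φ : MForm A) : MForm A :=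
  MForm.disj (MForm.next m n φ) (mNeg (MForm.next m n mTop))

/-- Weak previous `•̂_I φ := •_I φ ∨ ¬•_I ⊤`. -/
def mWPrev {A : Type} (m : ℕ) (n : ℕ∞) (φ : MForm A) : MForm A :=
  MForm.disj (MForm.prev m n φ) (mNeg (MForm.prev m n mTop))

/-- MHT-equivalence over strict timed HT-traces. -/
def mhtEquivStrict {A : Type} (φ ψ : MForm A) : Prop :=
  ∀ (H T : ℕ → Set A) (τ : ℕ → ℕ) (len : ℕ∞),
    isTrace H T τ len → isStrict τ len → ∀ k : ℕ, (k : ℕ∞) < len →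
      (sat φ H T τ len k ↔ sat ψ H T τ len k)

@[simp] theorem inIntv_zero_top (d : ℕ) : inIntv 0 ⊤ d := by
  simp [inIntv]

@[simp] theorem inIntv_zero_natCast (m d : ℕ) : inIntv 0 (m : ℕ∞) d ↔ d < m := by
  simp [inIntv]

@[simp] theorem sat_mTop {A : Type} (H T : ℕ → Set A) (τ : ℕ → ℕ) (len : ℕ∞) (k : ℕ) :
    sat mTop H T τ len k := by
  simp [mTop, mNeg, sat]

theorem inIntv.of_le {m d e : ℕ} {n : ℕ∞} (h : inIntv m n e) (hm : m ≤ d) (hde : d ≤ e) :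
    inIntv m n d :=
  ⟨hm, lt_of_le_of_lt (by exact_mod_cast hde) h.2⟩

theorem isStrict.le_of_le {τ : ℕ → ℕ} {len : ℕ∞} (h : isStrict τ len) {i j : ℕ} (hij : i ≤ j)
    (hj : (j : ℕ∞) < len) : τ i ≤ τ j := by
  induction j, hij using Nat.le_induction with
  | base => exact le_rfl
  | succ j _ ih =>
    have hj' : (j : ℕ∞) + 1 < len := by exact_mod_cast hj
    exact (ih (lt_of_le_of_lt le_self_add hj')).trans (h j hj').le

theorem lt_len_of_le {len : ℕ∞} {i j : ℕ} (hij : i ≤ j) (hj : (j : ℕ∞) < len) :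
    (i : ℕ∞) < len :=
  lt_of_le_of_lt (by exact_mod_cast hij) hj

section Semantic

variable {τ : ℕ → ℕ} {len : ℕ∞} (hτ : isStrict τ len) (P Q : ℕ → Prop) (n : ℕ∞) {k : ℕ}

include hτ

theorem until_iff {m : ℕ} (hm : 0 < m) :
    (∃ j, k ≤ j ∧ (j : ℕ∞) < len ∧ inIntv m n (τ j - τ k) ∧ Q j ∧ ∀ i, k ≤ i → i < j → P i) ↔
      (∃ j, k ≤ j ∧ (j : ℕ∞) < len ∧ inIntv m n (τ j - τ k) ∧ Q j) ∧
      ∀ i, k ≤ i → (i : ℕ∞) < len → τ i - τ k < m →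
        ∃ j, i ≤ j ∧ (j : ℕ∞) < len ∧ (P j ∧ (j : ℕ∞) + 1 < len ∧ Q (j + 1)) ∧
          ∀ l, i ≤ l → l < j → P l := by
  constructor
  · rintro ⟨j, hkj, hj, hI, hQ, hP⟩
    refine ⟨⟨j, hkj, hj, hI, hQ⟩, fun i hki hi him => ?_⟩
    have hij : i < j := by
      by_contra! hji
      have := hτ.le_of_le hji hi
      have := hI.1
      omega
    obtain ⟨j, rfl⟩ : ∃ j', j = j' + 1 := ⟨j - 1, by omega⟩
    exact ⟨j, by omega, lt_len_of_le (Nat.le_succ j) hj,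
      ⟨hP j (by omega) (by omega), by exact_mod_cast hj, hQ⟩,
      fun l _ _ => hP l (by omega) (by omega)⟩
  · rintro ⟨⟨j, hkj, hj, hI, hQ⟩, h⟩
    have hP : ∀ i, k ≤ i → (i : ℕ∞) < len → τ i - τ k < m → P i := by
      intro i hki hi him
      obtain ⟨j', hij', -, ⟨hPj', -⟩, hl⟩ := h i hki hi him
      rcases hij'.eq_or_lt with rfl | hlt
      · exact hPj'
      · exact hl i le_rfl hlt
    classical
    have hex : ∃ s, k ≤ s ∧ m ≤ τ s - τ k := ⟨j, hkj, hI.1⟩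
    obtain ⟨hks, hms⟩ := Nat.find_spec hex
    have hsj : Nat.find hex ≤ j := Nat.find_min' hex ⟨hkj, hI.1⟩
    have hmin : ∀ i, k ≤ i → i < Nat.find hex → τ i - τ k < m := fun i hki hi => by
      have := Nat.find_min hex hi
      grind
    generalize Nat.find hex = s at *
    have hks' : k < s := lt_of_le_of_ne hks (by rintro rfl; omega)
    obtain ⟨j', hij', hj', ⟨hPj', hj1, hQ'⟩, hl⟩ := h (s - 1) (by omega)
      (lt_len_of_le (by omega) hj) (hmin _ (by omega) (by omega))
    have hPre : ∀ i, k ≤ i → i ≤ j' → (i : ℕ∞) < len → P i := fun i hki hi hil => by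
      rcases lt_or_ge i s with his | his
      · exact hP i hki hil (hmin i hki his)
      · rcases hi.eq_or_lt with rfl | hlt
        · exact hPj'
        · exact hl i (by omega) hlt
    rcases le_or_gt (j' + 1) j with hle | hlt
    · have h1 := hτ.le_of_le hle hj
      have h2 := hτ.le_of_le (show s ≤ j' + 1 by omega) (lt_len_of_le hle hj)
      exact ⟨j' + 1, by omega, lt_len_of_le hle hj, hI.of_le (by omega) (by omega), hQ',
        fun i hki hi => hPre i hki (by omega) (lt_len_of_le (by omega) hj)⟩
    · exact ⟨j, hkj, hj, hI, hQ,
        fun i hki hi => hPre i hki (by omega) (lt_len_of_le hi.le hj)⟩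

theorem until_zero_iff :
    (∃ j, k ≤ j ∧ (j : ℕ∞) < len ∧ inIntv 0 n (τ j - τ k) ∧ Q j ∧ ∀ i, k ≤ i → i < j → P i) ↔
      (∃ j, k ≤ j ∧ (j : ℕ∞) < len ∧ inIntv 0 n (τ j - τ k) ∧ Q j) ∧
      ∃ j, k ≤ j ∧ (j : ℕ∞) < len ∧ Q j ∧ ∀ i, k ≤ i → i < j → P i := by
  constructor
  · rintro ⟨j, hkj, hj, hI, hQ, hP⟩
    exact ⟨⟨j, hkj, hj, hI, hQ⟩, j, hkj, hj, hQ, hP⟩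
  · rintro ⟨⟨j, hkj, hj, hI, hQ⟩, j', hkj', hj', hQ', hP'⟩
    rcases le_total j' j with hle | hle
    · have := hτ.le_of_le hle hj
      exact ⟨j', hkj', hj', hI.of_le (Nat.zero_le _) (by omega), hQ', hP'⟩
    · exact ⟨j, hkj, hj, hI, hQ, fun i hki hi => hP' i hki (by omega)⟩

theorem since_iff {m : ℕ} (hm : 0 < m) (hk : (k : ℕ∞) < len) :
    (∃ j, j ≤ k ∧ inIntv m n (τ k - τ j) ∧ Q j ∧ ∀ i, j < i → i ≤ k → P i) ↔
      (∃ j, j ≤ k ∧ inIntv m n (τ k - τ j) ∧ Q j) ∧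
      ∀ i, i ≤ k → τ k - τ i < m →
        ∃ j, j ≤ i ∧ (P j ∧ 0 < j ∧ Q (j - 1)) ∧ ∀ l, j < l → l ≤ i → P l := by
  constructor
  · rintro ⟨j, hjk, hI, hQ, hP⟩
    refine ⟨⟨j, hjk, hI, hQ⟩, fun i hik him => ?_⟩
    have hij : j < i := by
      by_contra! hij
      have := hτ.le_of_le hij (lt_len_of_le hjk hk)
      have := hI.1
      omega
    exact ⟨j + 1, hij, ⟨hP _ (by omega) (by omega), by omega, hQ⟩,
      fun l _ _ => hP l (by omega) (by omega)⟩
  · rintro ⟨⟨j, hjk, hI, hQ⟩, h⟩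
    have hP : ∀ i, i ≤ k → τ k - τ i < m → P i := by
      intro i hik him
      obtain ⟨j', hji, ⟨hPj', -⟩, hl⟩ := h i hik him
      rcases hji.eq_or_lt with rfl | hlt
      · exact hPj'
      · exact hl i hlt le_rfl
    classical
    have hex : ∃ s, τ k - τ s < m := ⟨k, by omega⟩
    have hs := Nat.find_spec hex
    have hsk : Nat.find hex ≤ k := Nat.find_min' hex (by omega)
    have hmin : ∀ i, i < Nat.find hex → m ≤ τ k - τ i := fun i hi =>
      not_lt.1 (Nat.find_min hex hi)
    generalize Nat.find hex = s at *
    have hsP : ∀ i, s ≤ i → i ≤ k → P i := fun i hsi hik => by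
      have := hτ.le_of_le hsi (lt_len_of_le hik hk)
      exact hP i hik (by omega)
    have hjs : j < s := by
      by_contra! hsj
      have := hτ.le_of_le hsj (lt_len_of_le hjk hk)
      have := hI.1
      omega
    obtain ⟨j', hj's, ⟨hPj', hj0, hQ'⟩, hl⟩ := h s hsk hs
    have hPre : ∀ i, j' ≤ i → i ≤ k → P i := fun i hi hik => by
      rcases le_or_gt s i with his | his
      · exact hsP i his hik
      · rcases hi.eq_or_lt with rfl | hlt
        · exact hPj'
        · exact hl i hlt his.le
    rcases le_or_gt j (j' - 1) with hle | hlt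
    · have := hτ.le_of_le hle (lt_len_of_le (show j' - 1 ≤ k by omega) hk)
      exact ⟨j' - 1, by omega, hI.of_le (hmin _ (by omega)) (by omega), hQ',
        fun i hi hik => hPre i (by omega) hik⟩
    · exact ⟨j, hjk, hI, hQ, fun i hi hik => hPre i (by omega) hik⟩

theorem since_zero_iff (hk : (k : ℕ∞) < len) :
    (∃ j, j ≤ k ∧ inIntv 0 n (τ k - τ j) ∧ Q j ∧ ∀ i, j < i → i ≤ k → P i) ↔
      (∃ j, j ≤ k ∧ inIntv 0 n (τ k - τ j) ∧ Q j) ∧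
      ∃ j, j ≤ k ∧ Q j ∧ ∀ i, j < i → i ≤ k → P i := by
  constructor
  · rintro ⟨j, hjk, hI, hQ, hP⟩
    exact ⟨⟨j, hjk, hI, hQ⟩, j, hjk, hQ, hP⟩
  · rintro ⟨⟨j, hjk, hI, hQ⟩, j', hjk', hQ', hP'⟩
    rcases le_total j j' with hle | hle
    · have := hτ.le_of_le hle (lt_len_of_le hjk' hk)
      exact ⟨j', hjk', hI.of_le (Nat.zero_le _) (by omega), hQ', hP'⟩
    · exact ⟨j, hjk, hI, hQ, fun i hi hik => hP' i (by omega) hik⟩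

end Semantic

/-- Unary-normal-form equivalences for half-open intervals (Proposition 10). -/
theorem unary_normal_form {A : Type} (φ ψ : MForm A) (m : ℕ) (n : ℕ∞) (hm : 0 < m) :
    mhtEquivStrict (MForm.untl m n φ ψ)
      (MForm.conj (mEvent m n ψ)
        (mAlways 0 (m : ℕ∞) (MForm.untl 0 ⊤ φ (MForm.conj φ (MForm.next 0 ⊤ ψ))))) ∧
    mhtEquivStrict (MForm.untl 0 n φ ψ)
      (MForm.conj (mEvent 0 n ψ) (MForm.untl 0 ⊤ φ ψ)) ∧
    mhtEquivStrict (MForm.rel m n φ ψ)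
      (MForm.disj (mAlways m n ψ)
        (mEvent 0 (m : ℕ∞) (MForm.rel 0 ⊤ φ (MForm.disj φ (mWNext 0 ⊤ ψ))))) ∧
    mhtEquivStrict (MForm.rel 0 n φ ψ)
      (MForm.disj (mAlways 0 n ψ) (MForm.rel 0 ⊤ φ ψ)) ∧
    mhtEquivStrict (MForm.since m n φ ψ)
      (MForm.conj (mEvB m n ψ)
        (mAlwB 0 (m : ℕ∞) (MForm.since 0 ⊤ φ (MForm.conj φ (MForm.prev 0 ⊤ ψ))))) ∧
    mhtEquivStrict (MForm.since 0 n φ ψ)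
      (MForm.conj (mEvB 0 n ψ) (MForm.since 0 ⊤ φ ψ)) ∧
    mhtEquivStrict (MForm.trig m n φ ψ)
      (MForm.disj (mAlwB m n ψ)
        (mEvB 0 (m : ℕ∞) (MForm.trig 0 ⊤ φ (MForm.disj φ (mWPrev 0 ⊤ ψ))))) ∧
    mhtEquivStrict (MForm.trig 0 n φ ψ)
      (MForm.disj (mAlwB 0 n ψ) (MForm.trig 0 ⊤ φ ψ)) := by
  refine ⟨?_, ?_, ?_, ?_, ?_, ?_, ?_, ?_⟩ <;> intro H T τ len _ hτ k hk
  · simpa [sat, mEvent, mAlways] using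
      until_iff hτ (sat φ H T τ len) (sat ψ H T τ len) n hm (k := k)
  · simpa [sat, mEvent] using until_zero_iff hτ (sat φ H T τ len) (sat ψ H T τ len) n (k := k)
  · have h := not_congr <|
      until_iff hτ (fun i => ¬ sat φ H T τ len i) (fun i => ¬ sat ψ H T τ len i) n hm (k := k)
    rw [not_and_or] at h
    refine Iff.trans ?_ (h.trans (or_congr ?_ ?_))
    · simp only [sat]
      grind
    · simp only [sat, mAlways]
      grind
    · clear h
      simp only [not_forall, mEvent, mWNext, mNeg, sat, sat_mTop, inIntv_zero_top, inIntv_zero_natCast,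
        exists_prop, implies_true, and_true, or_false]
      refine exists_congr fun i => ?_
      grind
  · have h := not_congr <|
      until_zero_iff hτ (fun i => ¬ sat φ H T τ len i) (fun i => ¬ sat ψ H T τ len i) n (k := k)
    simp [sat, mAlways]
    grind
  · simpa [sat, mEvB, mAlwB] using
      since_iff hτ (sat φ H T τ len) (sat ψ H T τ len) n hm hk
  · simpa [sat, mEvB] using since_zero_iff hτ (sat φ H T τ len) (sat ψ H T τ len) n hk
  · have h := not_congr <|
      since_iff hτ (fun i => ¬ sat φ H T τ len i) (fun i => ¬ sat ψ H T τ len i) n hm hk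
    rw [not_and_or] at h
    refine Iff.trans ?_ (h.trans (or_congr ?_ ?_))
    · simp only [sat]
      grind
    · simp only [sat, mAlwB]
      grind
    · clear h
      simp only [not_forall, mEvB, mWPrev, mNeg, sat, sat_mTop, inIntv_zero_top, inIntv_zero_natCast,
        exists_prop, implies_true, and_true, or_false]
      refine exists_congr fun i => ?_
      grind
  · have h := not_congr <|
      since_zero_iff hτ (fun i => ¬ sat φ H T τ len i) (fun i => ¬ sat ψ H T τ len i) n hk
    simp [sat, mAlwB]
    grind
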